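/- For every permutation σ ∈ S_N, the partition functions satisfy the exchange relation ∏_{1≤j<k≤N, σ(j)>σ(k)} [1 + u_{σ(k)} − u_{σ(j)}] · W_{M,N}(u₁,…,u_N|v₁,…,v_M|x₁,…,x_N|a₁₂) = ∏_{1≤j<k≤N, σ(j)>σ(k)} [1 + u_{σ(j)} − u_{σ(k)}] · W_{M,N}(u_{σ(1)},…,u_{σ(N)}|v₁,…,v_M|x₁,…,x_N|a₁₂). -/

import Mathlib

open Complex

noncomputable section

/-- The half period magnitude `K₁` for elliptic nome `q`. -/
def Kone (q : ℝ) : ℝ :=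
  Real.pi / 2 * ∏' n : ℕ,
    ((1 + q ^ (2 * n + 1)) / (1 - q ^ (2 * n + 1)) *
      ((1 - q ^ (2 * n + 2)) / (1 + q ^ (2 * n + 2)))) ^ 2

/-- The half period magnitude `K₂` for elliptic nome `q`. -/
def Ktwo (q : ℝ) : ℝ := -(Kone q / Real.pi) * Real.log q

/-- The elliptic theta function `H`. -/
def theta (q : ℝ) (u : ℂ) : ℂ :=
  2 * (q : ℂ) ^ (1 / 4 : ℂ) * Complex.sin (Real.pi * u / (2 * (Kone q : ℂ))) *
    ∏' n : ℕ,
      ((1 - 2 * (q : ℂ) ^ (2 * n + 2) * Complex.cos (Real.pi * u / (Kone q : ℂ)) +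
          (q : ℂ) ^ (4 * n + 4)) * (1 - (q : ℂ) ^ (2 * n + 2)))

/-- The bracket `[u] = H(λu)`. -/
def brak (q : ℝ) (lam : ℂ) (u : ℂ) : ℂ := theta q (lam * u)

/-- Unit vector ê₁. -/
def e1 : ℤ × ℤ := (1, 0)

/-- Unit vector ê₂. -/
def e2 : ℤ × ℤ := (0, 1)

/-- The scalar `a₁₂ = a₁ + a₂ + ω₁₂` attached to a state vector. -/
def aSc (ω12 : ℂ) (a : ℤ × ℤ) : ℂ := (a.1 : ℂ) + (a.2 : ℂ) + ω12

/-- The face weights of the Deguchi-Martin model. -/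
def faceW (q : ℝ) (lam ω12 : ℂ) (a b c d : ℤ × ℤ) (u v : ℂ) : ℂ :=
  if b = a + e1 ∧ c = a + e1 ∧ d = a + e1 + e1 then
    brak q lam (1 + (u - v)) / brak q lam 1
  else if b = a + e2 ∧ c = a + e2 ∧ d = a + e2 + e2 then
    brak q lam (1 - (u - v)) / brak q lam 1
  else if b = a + e2 ∧ c = a + e1 ∧ d = a + e1 + e2 then
    brak q lam (u - v) * brak q lam (aSc ω12 a - 1) / (brak q lam 1 * brak q lam (aSc ω12 a))
  else if b = a + e1 ∧ c = a + e2 ∧ d = a + e1 + e2 then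
    brak q lam (u - v) * brak q lam (-aSc ω12 a - 1) / (brak q lam 1 * brak q lam (-aSc ω12 a))
  else if b = a + e1 ∧ c = a + e1 ∧ d = a + e1 + e2 then
    brak q lam (aSc ω12 a - (u - v)) / brak q lam (aSc ω12 a)
  else if b = a + e2 ∧ c = a + e2 ∧ d = a + e1 + e2 then
    brak q lam (-aSc ω12 a - (u - v)) / brak q lam (-aSc ω12 a)
  else 0

/-- Number of the integers `x₁ < ⋯ < x_N` that are `≤ k`. -/
def btmCount (N : ℕ) (x : ℕ → ℕ) (k : ℕ) : ℕ :=
  ((Finset.Icc 1 N).filter fun j => x j ≤ k).card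

open scoped Classical in
/-- The partition function `W_{M,N}(u₁,…,u_N|v₁,…,v_M|x₁,…,x_N|a₁₂)` of the
Deguchi-Martin model: the sum over all state-vector configurations of the
`N`-row, `M`-column lattice with the prescribed boundary of the product of all
`M·N` face weights. -/
def partW (q : ℝ) (lam ω12 : ℂ) (M N : ℕ) (u v : ℕ → ℂ) (x : ℕ → ℕ)
    (a : ℤ × ℤ) : ℂ :=
  ∑' s : Fin (N + 1) × Fin (M + 1) → ℤ × ℤ,
    if (∀ k : Fin (M + 1), s (0, k) = a + ((k : ℕ) : ℤ) • e1) ∧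
       (∀ i : Fin (N + 1), s (i, 0) = a + ((i : ℕ) : ℤ) • e1) ∧
       (∀ i : Fin (N + 1), s (i, Fin.last M) = a + (M : ℤ) • e1 + ((i : ℕ) : ℤ) • e2) ∧
       (∀ k : Fin (M + 1), s (Fin.last N, k) =
          a + ((N : ℤ) + ((k : ℕ) : ℤ) - (btmCount N x (k : ℕ) : ℤ)) • e1 +
            (btmCount N x (k : ℕ) : ℤ) • e2)
    then
      ∏ i : Fin N, ∏ k : Fin M,
        faceW q lam ω12 (s (i.castSucc, k.castSucc)) (s (i.castSucc, k.succ))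
          (s (i.succ, k.castSucc)) (s (i.succ, k.succ)) (u (N - (i : ℕ))) (v ((k : ℕ) + 1))
    else 0

/-- finite q-Pochhammer -/
def qp (q : ℝ) (n : ℕ) : ℝ := ∏ i ∈ Finset.range n, (1 - (q ^ 2) ^ (i + 1))

def qI (q : ℝ) (n : ℤ) : ℝ := if n < 0 then 0 else (qp q n.toNat)⁻¹

lemma qfac_pos {q : ℝ} (hq0 : 0 < q) (hq1 : q < 1) (i : ℕ) : 0 < 1 - (q ^ 2) ^ (i + 1) := by
  have h : q ^ 2 < 1 := by nlinarith
  have := pow_lt_one₀ (by positivity : 0 ≤ q ^ 2) h (Nat.succ_ne_zero i)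
  simpa using this

lemma qp_pos {q : ℝ} (hq0 : 0 < q) (hq1 : q < 1) (n : ℕ) : 0 < qp q n :=
  Finset.prod_pos fun i _ => qfac_pos hq0 hq1 i

lemma qp_succ (q : ℝ) (n : ℕ) : qp q (n + 1) = qp q n * (1 - (q ^ 2) ^ (n + 1)) := by
  simp [qp, Finset.prod_range_succ]

lemma qI_pred {q : ℝ} (hq0 : 0 < q) (hq1 : q < 1) (n : ℤ) :
    qI q (n - 1) = (1 - (q ^ 2) ^ n) * qI q n := by
  rcases lt_trichotomy n 0 with h | h | h
  · simp [qI, h, show n - 1 < 0 by omega]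
  · subst h; simp [qI]
  · obtain ⟨m, rfl⟩ : ∃ m : ℕ, n = m + 1 := ⟨(n - 1).toNat, by omega⟩
    have h1 : ¬ ((m : ℤ) + 1 < 0) := by omega
    have h2 : ((m : ℤ) + 1).toNat = m + 1 := by omega
    simp only [qI, add_sub_cancel_right, h1, if_false, h2, Int.toNat_natCast, qp_succ]
    have := (qfac_pos hq0 hq1 m).ne'
    have h4 := (qp_pos hq0 hq1 m).ne'
    have h3 : ((q : ℝ) ^ 2) ^ ((m : ℤ) + 1) = (q ^ 2) ^ (m + 1) := by norm_cast
    rw [h3, if_neg (by omega)]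
    field_simp

def qG (q : ℝ) (m : ℕ) (k : ℤ) : ℝ :=
  (-1) ^ k * q ^ (k ^ 2 + k) * (qp q (2 * m + 1) * qI q (m - k) * qI q (m + 1 + k))

lemma qG_rec {q : ℝ} (hq0 : 0 < q) (hq1 : q < 1) (m : ℕ) (k : ℤ) :
    qG q (m + 1) k = (1 + (q ^ 2) ^ (2 * m + 2)) * qG q m k
      - (q ^ 2) ^ (m + 1) * (qG q m (k - 1) + qG q m (k + 1)) := by
  have hq : q ≠ 0 := hq0.ne'
  have ha := qI_pred hq0 hq1 ((m : ℤ) + 1 - k)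
  have ha' := qI_pred hq0 hq1 ((m : ℤ) - k)
  have hb := qI_pred hq0 hq1 ((m : ℤ) + 2 + k)
  have hb' := qI_pred hq0 hq1 ((m : ℤ) + 1 + k)
  rw [show (m : ℤ) + 1 - k - 1 = m - k by ring] at ha
  rw [show (m : ℤ) + 2 + k - 1 = m + 1 + k by ring] at hb
  simp only [qG]
  rw [show 2 * (m + 1) + 1 = 2 * m + 1 + 1 + 1 by ring, qp_succ, qp_succ]
  rw [show ((m + 1 : ℕ) : ℤ) - k = m + 1 - k by push_cast; ring,
    show ((m + 1 : ℕ) : ℤ) + 1 + k = m + 2 + k by push_cast; ring,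
    show (m : ℤ) - (k - 1) = m + 1 - k by ring,
    show (m : ℤ) + 1 + (k - 1) = m + 1 + k - 1 by ring,
    show (m : ℤ) - (k + 1) = m - k - 1 by ring,
    show (m : ℤ) + 1 + (k + 1) = m + 2 + k by ring, hb', ha', ha, hb]
  have e1 : q ^ ((k - 1) ^ 2 + (k - 1)) = q ^ (k ^ 2 + k) * (q ^ 2) ^ (-k) := by
    rw [← zpow_natCast, ← zpow_mul, ← zpow_add₀ hq]; congr 1; push_cast; ring
  have e2 : q ^ ((k + 1) ^ 2 + (k + 1)) = q ^ (k ^ 2 + k) * (q ^ 2) ^ (k + 1) := by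
    rw [← zpow_natCast, ← zpow_mul, ← zpow_add₀ hq]; congr 1; push_cast; ring
  rw [e1, e2]
  have s1 : (-1 : ℝ) ^ (k - 1) = - (-1) ^ k := by
    rw [zpow_sub₀ (by norm_num)]; simp [div_neg]
  have s2 : (-1 : ℝ) ^ (k + 1) = - (-1) ^ k := by
    rw [zpow_add₀ (by norm_num)]; simp
  rw [s1, s2]
  have hp : q ^ 2 ≠ 0 := by positivity
  generalize q ^ 2 = p at *
  have f1 : p ^ ((m : ℤ) + 1 - k) = p ^ m * p * (p ^ k)⁻¹ := by
    rw [zpow_sub₀ hp, zpow_add₀ hp]; simp [div_eq_mul_inv]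
  have f2 : p ^ ((m : ℤ) - k) = p ^ m * (p ^ k)⁻¹ := by
    rw [zpow_sub₀ hp]; simp [div_eq_mul_inv]
  have f3 : p ^ ((m : ℤ) + 2 + k) = p ^ m * p ^ 2 * p ^ k := by
    rw [zpow_add₀ hp, zpow_add₀ hp]; norm_cast
  have f4 : p ^ ((m : ℤ) + 1 + k) = p ^ m * p * p ^ k := by
    rw [zpow_add₀ hp, zpow_add₀ hp]; simp
  have f5 : p ^ (k + 1) = p ^ k * p := by rw [zpow_add₀ hp]; simp
  rw [f1, f2, f3, f4, f5, zpow_neg]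
  have hk : p ^ k ≠ 0 := zpow_ne_zero _ hp
  generalize p ^ k = x at *
  rw [show p ^ (2 * m + 1 + 1) = (p ^ m) ^ 2 * p ^ 2 by ring,
    show p ^ (2 * m + 1 + 1 + 1) = (p ^ m) ^ 2 * p ^ 3 by ring, pow_succ p m]
  generalize p ^ m = y at *
  field_simp
  ring

lemma qG_zero {q : ℝ} (hq0 : 0 < q) (hq1 : q < 1) (k : ℤ) :
    qG q 0 k = if k = 0 then 1 else if k = -1 then -1 else 0 := by
  have h1 := (qfac_pos hq0 hq1 0).ne'
  simp only [zero_add, pow_one] at h1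
  split_ifs with h h'
  · subst h; simp [qG, qI, qp, h1]
  · subst h'
    simp [qG, qI, qp, h1]
  · rcases lt_or_gt_of_ne h with h2 | h2
    · simp [qG, qI, show 1 + k < 0 by omega]
    · simp [qG, qI, h2]

lemma finite_jtp {q : ℝ} (hq0 : 0 < q) (hq1 : q < 1) {w : ℂ} (hw : w ≠ 0) (m : ℕ) :
    HasSum (fun k : ℤ => (qG q m k : ℂ) * w ^ k)
      ((1 - w⁻¹) * ∏ n ∈ Finset.range m,
        ((1 - ((q : ℂ) ^ 2) ^ (n + 1) * w) * (1 - ((q : ℂ) ^ 2) ^ (n + 1) * w⁻¹))) := by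
  induction m with
  | zero =>
    have := hasSum_sum_of_ne_finset_zero (L := SummationFilter.unconditional ℤ) (f := fun k : ℤ => (qG q 0 k : ℂ) * w ^ k)
      (s := {0, -1}) (by
        intro b hb
        simp only [Finset.mem_insert, Finset.mem_singleton, not_or] at hb
        simp [qG_zero hq0 hq1, hb.1, hb.2])
    convert this using 1
    simp [qG_zero hq0 hq1]; ring
  | succ m ih =>
    have h1 := ((Equiv.subRight (1 : ℤ)).hasSum_iff.mpr ih).mul_left w
    have h2 := ((Equiv.addRight (1 : ℤ)).hasSum_iff.mpr ih).mul_left w⁻¹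
    have h3 := (ih.mul_left (1 + ((q : ℂ) ^ 2) ^ (2 * m + 2))).sub
      ((h1.add h2).mul_left (((q : ℂ) ^ 2) ^ (m + 1)))
    convert h3 using 1
    · rfl
    · funext k
      rw [qG_rec hq0 hq1]
      simp only [Function.comp, Equiv.subRight_apply, Equiv.coe_addRight]
      rw [zpow_sub₀ hw, zpow_add₀ hw]
      push_cast
      field_simp
    · rw [Finset.prod_range_succ]
      field_simp
      ring

lemma summable_gauss {q : ℝ} (hq0 : 0 < q) (hq1 : q < 1) {r : ℝ} (hr : 0 < r) :
    Summable (fun k : ℤ => q ^ (k ^ 2) * r ^ k) := by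
  have h := (summable_jacobiTheta₂_term_iff (-I * (Real.log r / (2 * Real.pi) : ℝ))
    (-I * (Real.log q / Real.pi : ℝ))).mpr (by
      have : Real.log q < 0 := Real.log_neg hq0 hq1
      have h2 : Real.log q / Real.pi < 0 := div_neg_of_neg_of_pos this Real.pi_pos
      simp only [Complex.mul_im, Complex.neg_re, Complex.neg_im, Complex.I_re, Complex.I_im,
        Complex.ofReal_re, Complex.ofReal_im]
      linarith)
  have h := h.norm
  refine h.congr fun k => ?_
  rw [jacobiTheta₂_term, Complex.norm_exp]
  have hpi := Real.pi_ne_zero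
  have : (2 * Real.pi * I * k * (-I * (Real.log r / (2 * Real.pi) : ℝ)) +
      Real.pi * I * k ^ 2 * (-I * (Real.log q / Real.pi : ℝ)) : ℂ)
      = ((k * Real.log r + (k ^ 2 : ℤ) * Real.log q : ℝ) : ℂ) := by
    have hpi' : (Real.pi : ℂ) ≠ 0 := by exact_mod_cast hpi
    push_cast
    field_simp
    ring_nf
    simp
  rw [this, Complex.ofReal_re, Real.exp_add, mul_comm]
  congr 1
  · rw [mul_comm, Real.exp_mul, Real.exp_log hq0, Real.rpow_intCast]
  · rw [mul_comm, Real.exp_mul, Real.exp_log hr, Real.rpow_intCast]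


lemma summable_qpow {q : ℝ} (hq0 : 0 < q) (hq1 : q < 1) (c : ℝ) (n : ℕ) :
    Summable (fun i : ℕ => ‖-(((q : ℂ) ^ 2) ^ (i + n))‖ * c) := by
  have h : q ^ 2 < 1 := by nlinarith
  have := ((summable_geometric_of_lt_one (by positivity : 0 ≤ q ^ 2) h).mul_left
    ((q ^ 2) ^ n)).mul_right c
  refine this.congr fun i => ?_
  simp [abs_of_pos hq0, pow_add]
  ring_nf
  exact Or.inl trivial

lemma qp_lim {q : ℝ} (hq0 : 0 < q) (hq1 : q < 1) :
    ∃ C : ℝ, 0 < C ∧ Filter.Tendsto (qp q) Filter.atTop (nhds C) ∧ ∀ n, C ≤ qp q n := by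
  have h : q ^ 2 < 1 := by nlinarith
  have hs : Summable (fun i : ℕ => ‖-((q ^ 2) ^ (i + 1))‖) := by
    have := ((summable_geometric_of_lt_one (by positivity : 0 ≤ q ^ 2) h).mul_left (q ^ 2))
    refine this.congr fun i => ?_
    simp [pow_succ]; ring
  have hne := tprod_one_add_ne_zero_of_summable (R := ℝ) (f := fun i : ℕ => -((q ^ 2) ^ (i + 1)))
    (fun i => by have := qfac_pos hq0 hq1 i; rw [← sub_eq_add_neg]; exact this.ne') hs
  have hm := (multipliable_one_add_of_summable hs).hasProd.tendsto_prod_nat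
  set C := ∏' i : ℕ, (1 + -((q ^ 2) ^ (i + 1))) with hC
  have ht : Filter.Tendsto (qp q) Filter.atTop (nhds C) := by
    refine hm.congr fun n => ?_
    simp [qp, sub_eq_add_neg]
  have hanti : Antitone (qp q) := antitone_nat_of_succ_le fun n => by
    rw [qp_succ]
    have h1 := qp_pos hq0 hq1 n
    have : 0 < (q ^ 2) ^ (n + 1) := by positivity
    nlinarith
  have hle : ∀ n, C ≤ qp q n := fun n => hanti.le_of_tendsto ht n
  have h0 : 0 ≤ C := ge_of_tendsto' ht fun n => (qp_pos hq0 hq1 n).le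
  exact ⟨C, lt_of_le_of_ne h0 (Ne.symm hne), ht, hle⟩

lemma qp_le_one {q : ℝ} (hq0 : 0 < q) (hq1 : q < 1) (n : ℕ) : qp q n ≤ 1 :=
  Finset.prod_le_one (fun i _ => (qfac_pos hq0 hq1 i).le) fun i _ => by
    have : 0 < (q ^ 2) ^ (i + 1) := by positivity
    linarith

lemma summable_thetaTerm {q : ℝ} (hq0 : 0 < q) (hq1 : q < 1) {r : ℝ} (hr : 0 < r) :
    Summable (fun k : ℤ => q ^ (k ^ 2 + k) * r ^ k) := by
  refine (summable_gauss hq0 hq1 (mul_pos hq0 hr)).congr fun k => ?_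
  rw [mul_zpow, zpow_add₀ hq0.ne']; ring

lemma jtp {q : ℝ} (hq0 : 0 < q) (hq1 : q < 1) {w : ℂ} (hw : w ≠ 0) :
    (1 - w⁻¹) * ∏' n : ℕ, ((1 - ((q : ℂ) ^ 2) ^ (n + 1) * w) *
        (1 - ((q : ℂ) ^ 2) ^ (n + 1) * w⁻¹) * (1 - ((q : ℂ) ^ 2) ^ (n + 1)))
      = ∑' k : ℤ, ((((-1) ^ k * q ^ (k ^ 2 + k) : ℝ)) : ℂ) * w ^ k := by
  obtain ⟨C, hC0, hC, hCle⟩ := qp_lim hq0 hq1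
  have mul1 : ∀ c : ℂ, Multipliable (fun n : ℕ => 1 - ((q : ℂ) ^ 2) ^ (n + 1) * c) := by
    intro c
    have := multipliable_one_add_of_summable (R := ℂ)
      (f := fun i : ℕ => -(((q : ℂ) ^ 2) ^ (i + 1)) * c)
      ((summable_qpow hq0 hq1 ‖c‖ 1).congr fun i => by rw [norm_mul])
    refine this.congr fun i => by ring
  have mul2 : Multipliable (fun n : ℕ => (1 - ((q : ℂ) ^ 2) ^ (n + 1) * w) *
        (1 - ((q : ℂ) ^ 2) ^ (n + 1) * w⁻¹) * (1 - ((q : ℂ) ^ 2) ^ (n + 1))) := by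
    have := ((mul1 w).mul (mul1 w⁻¹)).mul (mul1 1)
    simpa using this
  have lim1 := mul2.hasProd.tendsto_prod_nat.const_mul (1 - w⁻¹)
  refine tendsto_nhds_unique lim1 ?_
  have hseq : ∀ m : ℕ, (1 - w⁻¹) * ∏ n ∈ Finset.range m, ((1 - ((q : ℂ) ^ 2) ^ (n + 1) * w) *
        (1 - ((q : ℂ) ^ 2) ^ (n + 1) * w⁻¹) * (1 - ((q : ℂ) ^ 2) ^ (n + 1)))
      = ∑' k : ℤ, (qp q m : ℂ) * ((qG q m k : ℂ) * w ^ k) := by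
    intro m
    rw [((finite_jtp hq0 hq1 hw m).mul_left (qp q m : ℂ)).tsum_eq, Finset.prod_mul_distrib]
    simp only [qp]
    push_cast
    ring
  refine Filter.Tendsto.congr (fun m => (hseq m).symm) ?_
  have hIle : ∀ n : ℤ, ‖qI q n‖ ≤ C⁻¹ := by
    intro n
    unfold qI
    split_ifs
    · simp [hC0.le]
    · rw [Real.norm_of_nonneg (inv_nonneg.mpr (qp_pos hq0 hq1 _).le)]
      exact inv_anti₀ hC0 (hCle _)
  have hIlim : ∀ g : ℕ → ℤ, Filter.Tendsto g Filter.atTop Filter.atTop →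
      Filter.Tendsto (fun m => qI q (g m)) Filter.atTop (nhds C⁻¹) := by
    intro g hg
    have h1 : Filter.Tendsto (fun m => (g m).toNat) Filter.atTop Filter.atTop := by
      refine Filter.tendsto_atTop.mpr fun b => ?_
      filter_upwards [Filter.tendsto_atTop.mp hg (b : ℤ)] with m hm
      omega
    have h2 := (hC.comp h1).inv₀ hC0.ne'
    refine h2.congr' ?_
    filter_upwards [Filter.tendsto_atTop.mp hg 0] with m hm
    simp [qI, not_lt.mpr hm]
  refine tendsto_tsum_of_dominated_convergence
    (bound := fun k : ℤ => q ^ (k ^ 2 + k) * ‖w‖ ^ k * (C⁻¹ * C⁻¹))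
    ((summable_thetaTerm hq0 hq1 (norm_pos_iff.mpr hw)).mul_right _) ?_ ?_
  · intro k
    have hcast : Filter.Tendsto (fun m : ℕ => (m : ℤ)) Filter.atTop Filter.atTop :=
      tendsto_natCast_atTop_atTop
    have t1 := hIlim (fun m => (m : ℤ) - k)
      (by simpa [sub_eq_add_neg] using Filter.tendsto_atTop_add_const_right _ (-k) hcast)
    have t2 := hIlim (fun m => (m : ℤ) + 1 + k)
      (by simpa [add_assoc] using Filter.tendsto_atTop_add_const_right _ (1 + k) hcast)
    have t3 : Filter.Tendsto (fun m : ℕ => qp q (2 * m + 1)) Filter.atTop (nhds C) :=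
      hC.comp (Filter.tendsto_atTop_mono (fun m => by simp only [id]; omega) Filter.tendsto_id)
    have t4 := (hC.mul ((t3.mul t1).mul t2)).mul_const ((-1) ^ k * q ^ (k ^ 2 + k))
    rw [show C * (C * C⁻¹ * C⁻¹) = 1 by field_simp, one_mul] at t4
    have t5 := (Complex.continuous_ofReal.tendsto _ |>.comp t4).mul_const (w ^ k)
    refine t5.congr fun m => ?_
    simp only [Function.comp, qG]
    push_cast
    ring
  · refine Filter.Eventually.of_forall fun m k => ?_
    simp only [qG]
    rw [norm_mul, norm_mul, Complex.norm_real, Complex.norm_real, norm_zpow]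
    simp only [norm_mul]
    have a1 : ‖qp q m‖ ≤ 1 := by
      rw [Real.norm_of_nonneg (qp_pos hq0 hq1 _).le]; exact qp_le_one hq0 hq1 _
    have a2 : ‖qp q (2 * m + 1)‖ ≤ 1 := by
      rw [Real.norm_of_nonneg (qp_pos hq0 hq1 _).le]; exact qp_le_one hq0 hq1 _
    have a3 : ‖((-1 : ℝ)) ^ k‖ = 1 := by simp
    have a4 : ‖q ^ (k ^ 2 + k)‖ = q ^ (k ^ 2 + k) := Real.norm_of_nonneg (by positivity)
    rw [a3, a4]
    calc ‖qp q m‖ * (1 * q ^ (k ^ 2 + k) * (‖qp q (2 * m + 1)‖ * ‖qI q (m - k)‖ *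
          ‖qI q (m + 1 + k)‖) * ‖w‖ ^ k)
        ≤ 1 * (1 * q ^ (k ^ 2 + k) * (1 * C⁻¹ * C⁻¹) * ‖w‖ ^ k) := by
          gcongr
          · exact hIle _
          · exact hIle _
      _ = _ := by ring

/-- the odd theta series -/
def serT (q : ℝ) (z : ℂ) : ℂ :=
  ∑' k : ℤ, (((-1) ^ k * q ^ (k ^ 2 + k) : ℝ) : ℂ) * cexp (I * (2 * k + 1) * z)

lemma theta_eq_serT {q : ℝ} (hq0 : 0 < q) (hq1 : q < 1) :
    ∃ C : ℂ, ∀ u : ℂ, theta q u = C * serT q (Real.pi * u / (2 * (Kone q : ℂ))) := by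
  refine ⟨2 * (q : ℂ) ^ (1 / 4 : ℂ) / (2 * I), fun u => ?_⟩
  unfold theta
  rw [show (Real.pi * u / (Kone q : ℂ)) = 2 * (Real.pi * u / (2 * (Kone q : ℂ))) by
    ring]
  generalize (Real.pi * u / (2 * (Kone q : ℂ))) = z
  have hw : cexp (2 * I * z) ≠ 0 := Complex.exp_ne_zero _
  have h := jtp hq0 hq1 hw
  have h1 : serT q z = cexp (I * z) *
      ∑' k : ℤ, ((((-1) ^ k * q ^ (k ^ 2 + k) : ℝ)) : ℂ) * cexp (2 * I * z) ^ k := by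
    unfold serT
    rw [← tsum_mul_left]
    refine tsum_congr fun k => ?_
    rw [← Complex.exp_int_mul, mul_left_comm, ← Complex.exp_add]
    congr 2
    ring
  rw [h1, ← h]
  have h2 : ∀ n : ℕ, ((1 - 2 * (q : ℂ) ^ (2 * n + 2) * Complex.cos (2 * z) +
          (q : ℂ) ^ (4 * n + 4)) * (1 - (q : ℂ) ^ (2 * n + 2)))
      = ((1 - ((q : ℂ) ^ 2) ^ (n + 1) * cexp (2 * I * z)) *
        (1 - ((q : ℂ) ^ 2) ^ (n + 1) * (cexp (2 * I * z))⁻¹) * (1 - ((q : ℂ) ^ 2) ^ (n + 1))) := by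
    intro n
    rw [Complex.cos, show -(2 * z) * I = - (2 * I * z) by ring, Complex.exp_neg,
      show 2 * z * I = 2 * I * z by ring]
    field_simp
    ring
  rw [tprod_congr h2]
  generalize (∏' n : ℕ, _ : ℂ) = Pr
  have h3 : Complex.sin z = cexp (I * z) * (1 - (cexp (2 * I * z))⁻¹) / (2 * I) := by
    rw [Complex.sin, ← Complex.exp_neg, mul_sub, ← Complex.exp_add,
      show I * z + -(2 * I * z) = -z * I by ring, mul_comm z I]
    field_simp
    ring_nf
    simp
  rw [h3]
  ring

def serE (q : ℝ) (z : ℂ) : ℂ :=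
  ∑' k : ℤ, ((q ^ (2 * k ^ 2) : ℝ) : ℂ) * cexp (I * (4 * k) * z)
def serO (q : ℝ) (z : ℂ) : ℂ :=
  ∑' k : ℤ, ((q ^ (2 * k ^ 2 + 2 * k) : ℝ) : ℂ) * cexp (I * (4 * k + 2) * z)

lemma norm_cexp_lin (b c : ℝ) (k : ℤ) (z : ℂ) : ‖cexp (I * (b * k + c) * z)‖
    = Real.exp (-c * z.im) * (Real.exp (-b * z.im)) ^ k := by
  rw [Complex.norm_exp, ← Real.rpow_intCast, ← Real.exp_mul, ← Real.exp_add]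
  congr 1
  simp
  ring

lemma summable_serT {q : ℝ} (hq0 : 0 < q) (hq1 : q < 1) (z : ℂ) : Summable fun k : ℤ =>
    ‖(((-1) ^ k * q ^ (k ^ 2 + k) : ℝ) : ℂ) * cexp (I * (2 * k + 1) * z)‖ := by
  refine ((summable_thetaTerm hq0 hq1 (Real.exp_pos (-2 * z.im))).mul_left
    (Real.exp (-1 * z.im))).congr fun k => ?_
  have := norm_cexp_lin 2 1 k z
  push_cast at this
  rw [norm_mul, this, Complex.norm_real, norm_mul]
  have a4 : ‖q ^ (k ^ 2 + k)‖ = q ^ (k ^ 2 + k) := Real.norm_of_nonneg (by positivity)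
  rw [a4]
  simp
  ring

lemma summable_serE {q : ℝ} (hq0 : 0 < q) (hq1 : q < 1) (z : ℂ) : Summable fun k : ℤ =>
    ‖((q ^ (2 * k ^ 2) : ℝ) : ℂ) * cexp (I * (4 * k) * z)‖ := by
  have h : q ^ 2 < 1 := by nlinarith
  refine (summable_gauss (pow_pos hq0 2) h (Real.exp_pos (-4 * z.im))).congr fun k => ?_
  have := norm_cexp_lin 4 0 k z
  push_cast at this
  rw [add_zero] at this
  rw [norm_mul, this, Complex.norm_real, Real.norm_of_nonneg (by positivity), zpow_mul]
  simp

lemma summable_serO {q : ℝ} (hq0 : 0 < q) (hq1 : q < 1) (z : ℂ) : Summable fun k : ℤ =>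
    ‖((q ^ (2 * k ^ 2 + 2 * k) : ℝ) : ℂ) * cexp (I * (4 * k + 2) * z)‖ := by
  have h : q ^ 2 < 1 := by nlinarith
  refine ((summable_thetaTerm (pow_pos hq0 2) h (Real.exp_pos (-4 * z.im))).mul_left
    (Real.exp (-2 * z.im))).congr fun k => ?_
  have := norm_cexp_lin 4 2 k z
  push_cast at this
  rw [norm_mul, this, Complex.norm_real, Real.norm_of_nonneg (by positivity), ← mul_add, zpow_mul]
  simp
  ring

/-- opposite parity reindexing -/
def parityEquiv : (ℤ × ℤ) ⊕ (ℤ × ℤ) ≃ ℤ × ℤ where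
  toFun := Sum.elim (fun p => (p.1 + p.2, p.1 - p.2)) (fun p => (p.1 + p.2, p.1 - p.2 - 1))
  invFun := fun m => if (m.1 - m.2) % 2 = 0 then Sum.inl ((m.1 + m.2) / 2, (m.1 - m.2) / 2)
    else Sum.inr ((m.1 + m.2 + 1) / 2, (m.1 - m.2 - 1) / 2)
  left_inv := by
    rintro (⟨a, b⟩ | ⟨a, b⟩)
    · have : (a + b - (a - b)) % 2 = 0 := by omega
      simp only [Sum.elim_inl, this, if_true, Sum.inl.injEq, Prod.mk.injEq]
      omega
    · have : ¬ (a + b - (a - b - 1)) % 2 = 0 := by omega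
      simp only [Sum.elim_inr, this, if_false, Sum.inr.injEq, Prod.mk.injEq]
      omega
  right_inv := by
    rintro ⟨m, n⟩
    by_cases h : (m - n) % 2 = 0
    · simp only [h, if_true, Sum.elim_inl, Prod.mk.injEq]
      omega
    · simp only [h, if_false, Sum.elim_inr, Prod.mk.injEq]
      omega

lemma serT_mul {q : ℝ} (hq0 : 0 < q) (hq1 : q < 1) (x y : ℂ) :
    serT q (x + y) * serT q (x - y) = serO q x * serE q y - serE q x * serO q y := by
  have hq : q ≠ 0 := hq0.ne'
  unfold serT serO serE
  rw [tsum_mul_tsum_of_summable_norm (summable_serT hq0 hq1 _) (summable_serT hq0 hq1 _),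
    tsum_mul_tsum_of_summable_norm (summable_serO hq0 hq1 _) (summable_serE hq0 hq1 _),
    tsum_mul_tsum_of_summable_norm (summable_serE hq0 hq1 _) (summable_serO hq0 hq1 _),
    ← parityEquiv.tsum_eq, sub_eq_add_neg (tsum _), ← tsum_neg]
  have hs := summable_mul_of_summable_norm (summable_serT hq0 hq1 (x + y))
    (summable_serT hq0 hq1 (x - y))
  rw [← parityEquiv.summable_iff] at hs
  have i1 : ∀ a b : ℤ, (((-1 : ℝ) ^ (a + b) * q ^ ((a + b) ^ 2 + (a + b)) : ℝ) : ℂ) *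
      (((-1 : ℝ) ^ (a - b) * q ^ ((a - b) ^ 2 + (a - b)) : ℝ) : ℂ) =
      ((q ^ (2 * a ^ 2 + 2 * a) : ℝ) : ℂ) * ((q ^ (2 * b ^ 2) : ℝ) : ℂ) := by
    intro a b
    rw [← Complex.ofReal_mul, ← Complex.ofReal_mul]
    congr 1
    rw [mul_mul_mul_comm, ← zpow_add₀ (by norm_num), ← zpow_add₀ hq, ← zpow_add₀ hq,
      Even.neg_one_zpow ⟨a, by ring⟩, one_mul]
    congr 1
    ring
  have i2 : ∀ a b : ℤ, (((-1 : ℝ) ^ (a + b) * q ^ ((a + b) ^ 2 + (a + b)) : ℝ) : ℂ) *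
      (((-1 : ℝ) ^ (a - b - 1) * q ^ ((a - b - 1) ^ 2 + (a - b - 1)) : ℝ) : ℂ) =
      -(((q ^ (2 * a ^ 2) : ℝ) : ℂ) * ((q ^ (2 * b ^ 2 + 2 * b) : ℝ) : ℂ)) := by
    intro a b
    rw [← Complex.ofReal_mul, ← Complex.ofReal_mul, ← Complex.ofReal_neg]
    congr 1
    rw [mul_mul_mul_comm, ← zpow_add₀ (by norm_num), ← zpow_add₀ hq, ← zpow_add₀ hq,
      Odd.neg_one_zpow ⟨a - 1, by ring⟩, neg_one_mul]
    congr 2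
    ring
  refine (Summable.tsum_sum (hs.comp_injective Sum.inl_injective)
    (hs.comp_injective Sum.inr_injective)).trans ?_
  congr 1
  · refine tsum_congr fun p => ?_
    obtain ⟨a, b⟩ := p
    simp only [Function.comp, parityEquiv, Equiv.coe_fn_mk, Sum.elim_inl]
    rw [mul_mul_mul_comm, i1, ← Complex.exp_add, mul_mul_mul_comm, ← Complex.exp_add]
    congr 2
    push_cast
    ring
  · refine tsum_congr fun p => ?_
    obtain ⟨a, b⟩ := p
    simp only [Function.comp, parityEquiv, Equiv.coe_fn_mk, Sum.elim_inr]
    rw [mul_mul_mul_comm, i2, neg_mul, ← Complex.exp_add, mul_mul_mul_comm, ← Complex.exp_add]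
    congr 3
    push_cast
    ring

lemma brak_det {q : ℝ} (hq0 : 0 < q) (hq1 : q < 1) (lam : ℂ) : ∃ O E : ℂ → ℂ, ∀ x y : ℂ,
    brak q lam (x + y) * brak q lam (x - y) = O x * E y - E x * O y := by
  obtain ⟨C, hC⟩ := theta_eq_serT hq0 hq1
  set t : ℂ := Real.pi * lam / (2 * (Kone q : ℂ)) with ht
  refine ⟨fun x => C * serO q (t * x), fun x => C * serE q (t * x), fun x y => ?_⟩
  have h : ∀ u, brak q lam u = C * serT q (t * u) := by
    intro u
    rw [brak, hC, ht]
    congr 2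
    ring
  rw [h, h, mul_mul_mul_comm, mul_add, mul_sub, serT_mul hq0 hq1]
  ring

lemma brak_neg (q : ℝ) (lam u : ℂ) : brak q lam (-u) = - brak q lam u := by
  simp only [brak, theta]
  rw [show (Real.pi * (lam * -u) / (Kone q : ℂ)) = -(Real.pi * (lam * u) / (Kone q : ℂ)) by ring,
    show (Real.pi * (lam * -u) / (2 * (Kone q : ℂ))) = -(Real.pi * (lam * u) / (2 * (Kone q : ℂ)))
      by ring, Complex.sin_neg, Complex.cos_neg]
  ring

/-- The Weierstrass four-bracket identity. -/
lemma brak_wei {q : ℝ} (hq0 : 0 < q) (hq1 : q < 1) (lam : ℂ) (a b c d a' b' c' d' a'' b'' c'' d'' : ℂ)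
    (h1 : a' + a = d'') (h2 : a + b + c'' = d'') (h3 : a + c + b'' = d'') (h4 : a + d + a'' = d'')
    (h5 : 2 * d'' = a + b + c + d) (h6 : b' + b = d'') (h7 : c' + c = d'') (h8 : d' + d = d'') :
    brak q lam a * brak q lam b * brak q lam c * brak q lam d =
      brak q lam a' * brak q lam b' * brak q lam c' * brak q lam d' -
      brak q lam a'' * brak q lam b'' * brak q lam c'' * brak q lam d'' := by
  obtain ⟨O, E, hOE⟩ := brak_det hq0 hq1 lam
  have t1 := hOE ((a + b) / 2) ((a - b) / 2)
  have t2 := hOE ((c + d) / 2) ((c - d) / 2)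
  have t3 := hOE ((c + d) / 2) ((a - b) / 2)
  have t4 := hOE ((a + b) / 2) ((c - d) / 2)
  have t5 := hOE ((c - d) / 2) ((a - b) / 2)
  have t6 := hOE ((c + d) / 2) ((a + b) / 2)
  rw [show (a + b) / 2 + (a - b) / 2 = a by ring, show (a + b) / 2 - (a - b) / 2 = b by ring] at t1
  rw [show (c + d) / 2 + (c - d) / 2 = c by ring, show (c + d) / 2 - (c - d) / 2 = d by ring] at t2
  rw [show (c + d) / 2 + (a - b) / 2 = b' by linear_combination -h5 / 2 - h6,
    show (c + d) / 2 - (a - b) / 2 = a' by linear_combination -h5 / 2 - h1] at t3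
  rw [show (a + b) / 2 + (c - d) / 2 = d' by linear_combination -h5 / 2 - h8,
    show (a + b) / 2 - (c - d) / 2 = c' by linear_combination -h5 / 2 - h7] at t4
  rw [show (c - d) / 2 + (a - b) / 2 = -b'' by linear_combination h3 + h5 / 2,
    show (c - d) / 2 - (a - b) / 2 = a'' by linear_combination -h5 / 2 - h4, brak_neg] at t5
  rw [show (c + d) / 2 + (a + b) / 2 = d'' by linear_combination - h5 / 2,
    show (c + d) / 2 - (a + b) / 2 = c'' by linear_combination -h5 / 2 - h2] at t6
  generalize brak q lam = f at *
  rw [show f a * f b * f c * f d = (f a * f b) * (f c * f d) by ring,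
    show f a' * f b' * f c' * f d' = (f b' * f a') * (f d' * f c') by ring,
    show f a'' * f b'' * f c'' * f d'' = -((-f b'' * f a'') * (f d'' * f c'')) by ring,
    t1, t2, t3, t4, t5, t6]
  ring

/-- Oddness together with the Weierstrass addition formula. -/
def WeiFun (f : ℂ → ℂ) : Prop :=
  (∀ x, f (-x) = -f x) ∧
  (∀ A s y : ℂ, f (1 + s) * f (1 + y) * f (A + (s + y)) * f A =
    f (A + y) * f (A + s) * f (1 + (s + y)) * f 1 +
      f y * f s * f (A - 1) * f (A + 1 + (s + y))) ∧
  (∀ A s y : ℂ, f (1 + s) * f (s + y) * f (A + 1 + y) * f A =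
    f (A + y) * f (A + 1) * f s * f (1 + (s + y)) +
      f y * f 1 * f (A - s) * f (A + 1 + (s + y))) ∧
  (∀ A s y : ℂ, f 1 ^ 3 * (f A * f (A - (s + y)) * f (A + 1 + s) * f (A + 1 + y)
      - f (A + 1) * f (A + 1 + (s + y)) * f (A - s) * f (A - y)) =
    f s * f y * f (1 + (s + y)) * (f (A - 1) * f (A + 1) ^ 3 - f A ^ 3 * f (A + 1 + 1)))

lemma brak_weiFun {q : ℝ} (hq0 : 0 < q) (hq1 : q < 1) (lam : ℂ) : WeiFun (brak q lam) := by
  refine ⟨brak_neg q lam, ?_, ?_, ?_⟩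
  · intro A s y
    have h := brak_wei hq0 hq1 lam (1 + s) (1 + y) (A + (s + y)) A (A + y) (A + s) 1 (1 + (s + y))
      y (-s) (A - 1) (A + 1 + (s + y)) (by ring) (by ring) (by ring) (by ring) (by ring) (by ring)
      (by ring) (by ring)
    rw [brak_neg] at h
    linear_combination h
  · intro A s y
    have h := brak_wei hq0 hq1 lam (1 + s) (s + y) (A + 1 + y) A (A + y) (A + 1) s (1 + (s + y))
      y (-1) (A - s) (A + 1 + (s + y)) (by ring) (by ring) (by ring) (by ring) (by ring) (by ring)
      (by ring) (by ring)
    rw [brak_neg] at h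
    linear_combination h
  · intro A s y
    have h := brak_wei hq0 hq1 lam A (A - (s + y)) (A + 1 + s) (A + 1 + y) (A + 1)
      (A + 1 + (s + y)) (A - s) (A - y) (-y) (-s) (1 + (s + y)) (2 * A + 1)
      (by ring) (by ring) (by ring) (by ring) (by ring) (by ring) (by ring) (by ring)
    have h2 := brak_wei hq0 hq1 lam (A - 1) (A + 1) (A + 1) (A + 1) (A + 1 + 1) A A A
      1 1 1 (2 * A + 1)
      (by ring) (by ring) (by ring) (by ring) (by ring) (by ring) (by ring) (by ring)
    rw [brak_neg, brak_neg] at h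
    linear_combination brak q lam 1 ^ 3 * h -
      brak q lam s * brak q lam y * brak q lam (1 + (s + y)) * h2

def wal (f : ℂ → ℂ) (u : ℂ) : ℂ := f (1 + u) / f 1
def wam (f : ℂ → ℂ) (u : ℂ) : ℂ := f (1 - u) / f 1
def wbe (f : ℂ → ℂ) (A u : ℂ) : ℂ := f u * f (A - 1) / (f 1 * f A)
def wbp (f : ℂ → ℂ) (A u : ℂ) : ℂ := f u * f (A + 1) / (f 1 * f A)
def wga (f : ℂ → ℂ) (A u : ℂ) : ℂ := f (A - u) / f A
def wgp (f : ℂ → ℂ) (A u : ℂ) : ℂ := f (A + u) / f A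

/-- relative face weight -/
def fw (f : ℂ → ℂ) (A : ℂ) (b c d : ℤ × ℤ) (u : ℂ) : ℂ :=
  if b = (1, 0) ∧ c = (1, 0) ∧ d = (2, 0) then wal f u
  else if b = (0, 1) ∧ c = (0, 1) ∧ d = (0, 2) then wam f u
  else if b = (0, 1) ∧ c = (1, 0) ∧ d = (1, 1) then wbe f A u
  else if b = (1, 0) ∧ c = (0, 1) ∧ d = (1, 1) then wbp f A u
  else if b = (1, 0) ∧ c = (1, 0) ∧ d = (1, 1) then wga f A u
  else if b = (0, 1) ∧ c = (0, 1) ∧ d = (1, 1) then wgp f A u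
  else 0

lemma faceW_rel (q : ℝ) (lam ω : ℂ) (P x0 x1 x2 x3 : ℤ × ℤ) (u v : ℂ) :
    faceW q lam ω (P + x0) (P + x1) (P + x2) (P + x3) u v =
      fw (brak q lam) (aSc ω P + ((x0.1 + x0.2 : ℤ) : ℂ)) (x1 - x0) (x2 - x0) (x3 - x0) (u - v) := by
  have hA : aSc ω (P + x0) = aSc ω P + ((x0.1 + x0.2 : ℤ) : ℂ) := by
    simp [aSc]; ring
  have hadd : ∀ y z : ℤ × ℤ, P + y = P + x0 + z ↔ y - x0 = z := by
    intro y z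
    constructor
    · intro h
      have : y = x0 + z := add_left_cancel (by rw [h, add_assoc])
      rw [this]; abel
    · rintro rfl; abel
  have hadd2 : ∀ y z w : ℤ × ℤ, P + y = P + x0 + z + w ↔ y - x0 = z + w := by
    intro y z w
    rw [add_assoc (P + x0), hadd]
  unfold faceW fw
  simp only [hA, hadd, hadd2, e1, e2, Prod.mk_add_mk, wal, wam, wbe, wbp, wga, wgp]
  generalize aSc ω P + ((x0.1 + x0.2 : ℤ) : ℂ) = A
  rw [show -A - 1 = -(A + 1) by ring, show -A - (u - v) = -(A + (u - v)) by ring,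
    brak_neg, brak_neg, brak_neg]
  simp only [neg_div_neg_eq, mul_neg]
  norm_num


def FF (f : ℂ → ℂ) (A : ℂ) (x0 x1 x2 x3 : ℤ × ℤ) (u : ℂ) : ℂ :=
  fw f (A + ((x0.1 + x0.2 : ℤ) : ℂ)) (x1 - x0) (x2 - x0) (x3 - x0) u

lemma wei_n {f : ℂ → ℂ} (hf : WeiFun f) (A s y : ℂ) :
    (f (1 + s) * f (1 + y) * f (A + 1 - (s + y)) * f (A + 1) =
      f (A + 1 - y) * f (A + 1 - s) * f (1 + (s + y)) * f 1 +
        f y * f s * f (A + 1 + 1) * f (A - (s + y))) ∧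
    (f (1 + s) * f (s + y) * f (A - y) * f (A + 1) =
      f (A + 1 - y) * f A * f s * f (1 + (s + y)) +
        f y * f 1 * f (A + 1 + s) * f (A - (s + y))) := by
  obtain ⟨ho, W1, W2, -⟩ := hf
  have a1 := W1 (-(A + 1)) s y
  have a2 := W2 (-(A + 1)) s y
  rw [show -(A + 1) + (s + y) = -(A + 1 - (s + y)) by ring,
    show -(A + 1) + y = -(A + 1 - y) by ring, show -(A + 1) + s = -(A + 1 - s) by ring,
    show -(A + 1) - 1 = -(A + 1 + 1) by ring,
    show -(A + 1) + 1 + (s + y) = -(A - (s + y)) by ring] at a1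
  rw [show -(A + 1) + 1 + y = -(A - y) by ring,
    show -(A + 1) + y = -(A + 1 - y) by ring, show -(A + 1) + 1 = -A by ring,
    show -(A + 1) - s = -(A + 1 + s) by ring,
    show -A + (s + y) = -(A - (s + y)) by ring] at a2
  simp only [ho] at a1 a2
  exact ⟨by linear_combination a1, by linear_combination a2⟩

/-- All forms of the addition formula used below. -/
lemma wei_m {f : ℂ → ℂ} (hf : WeiFun f) (A s y : ℂ) :
    (f (1 - s) * f (1 - y) * f (A - (s + y)) * f A =
      f (A - y) * f (A - s) * f (1 - (s + y)) * f 1 +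
        f y * f s * f (A - 1) * f (A + 1 - (s + y))) ∧
    (f (1 - s) * f (s + y) * f (A + 1 - y) * f A =
      f (A - y) * f (A + 1) * f s * f (1 - (s + y)) +
        f y * f 1 * f (A + s) * f (A + 1 - (s + y))) ∧
    (f 1 ^ 3 * (f A * f (A + (s + y)) * f (A + 1 - s) * f (A + 1 - y)
      - f (A + 1) * f (A + 1 - (s + y)) * f (A + s) * f (A + y)) =
      f s * f y * f (1 - (s + y)) *
        (f (A - 1) * f (A + 1) ^ 3 - f A ^ 3 * f (A + 1 + 1))) ∧
    (f (1 - s) * f (1 - y) * f (A + 1 + (s + y)) * f (A + 1) =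
      f (A + 1 + y) * f (A + 1 + s) * f (1 - (s + y)) * f 1 +
        f y * f s * f (A + 1 + 1) * f (A + (s + y))) ∧
    (f (1 - s) * f (s + y) * f (A + y) * f (A + 1) =
      f (A + 1 + y) * f A * f s * f (1 - (s + y)) +
        f y * f 1 * f (A + 1 - s) * f (A + (s + y))) := by
  obtain ⟨b1, b2⟩ := wei_n hf A (-s) (-y)
  obtain ⟨ho, W1, W2, W3⟩ := hf
  have a1 := W1 A (-s) (-y)
  have a2 := W2 A (-s) (-y)
  have a3 := W3 A (-s) (-y)
  have hs : -s + -y = -(s + y) := by ring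
  simp only [hs, ← sub_eq_add_neg, sub_neg_eq_add, ho] at a1 a2 a3 b1 b2
  exact ⟨by linear_combination a1, by linear_combination -a2, by linear_combination a3,
    by linear_combination b1, by linear_combination -b2⟩

set_option maxHeartbeats 4000000 in
lemma ybe_rel (f : ℂ → ℂ) (hf : WeiFun f) (h1 : f 1 ≠ 0) (A : ℂ) (hA : f A ≠ 0)
    (hB : f (A + 1) ≠ 0) (s y : ℂ) (p r dq dqq dg : ℤ × ℤ)
    (hp : p = (1, 0) ∨ p = (0, 1)) (hr : r = (1, 0) ∨ r = (0, 1))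
    (hdq : dq = (1, 0) ∨ dq = (0, 1)) (hdqq : dqq = (1, 0) ∨ dqq = (0, 1))
    (hdg : dg = (1, 0) ∨ dg = (0, 1)) :
    FF f A 0 p r (p + (1, 0)) (s + y) * FF f A r (p + (1, 0)) (r + dq) (r + dq + dqq) s *
        FF f A p (p + dg) (p + (1, 0)) (r + dq + dqq) y +
      FF f A 0 p r (p + (0, 1)) (s + y) * FF f A r (p + (0, 1)) (r + dq) (r + dq + dqq) s *
        FF f A p (p + dg) (p + (0, 1)) (r + dq + dqq) y =
    FF f A 0 (1, 0) r (r + dq) y * FF f A 0 p (1, 0) (p + dg) s *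
        FF f A (1, 0) (p + dg) (r + dq) (r + dq + dqq) (s + y) +
      FF f A 0 (0, 1) r (r + dq) y * FF f A 0 p (0, 1) (p + dg) s *
        FF f A (0, 1) (p + dg) (r + dq) (r + dq + dqq) (s + y) := by
  obtain ⟨n1, n2⟩ := wei_n hf A s y
  obtain ⟨-, n3⟩ := wei_n hf A y s
  obtain ⟨m1, m2, m3, m4, m5⟩ := wei_m hf A s y
  obtain ⟨-, m6, -, -, m7⟩ := wei_m hf A y s
  have w1 := hf.2.1 A s y
  have w2 := hf.2.2.1 A s y
  have w3 := hf.2.2.2 A s y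
  have w4 := hf.2.2.1 A y s
  rw [add_comm y s] at n3 m6 m7 w4
  have hAA : A + 1 - 1 = A := by ring
  clear hf
  rcases hp with rfl | rfl <;> rcases hr with rfl | rfl <;> rcases hdq with rfl | rfl <;>
    rcases hdqq with rfl | rfl <;> rcases hdg with rfl | rfl <;> norm_num [FF, fw] <;> (try ring1) <;>
    simp only [wal, wam, wbe, wbp, wga, wgp, hAA] <;> field_simp <;>
    first
      | ring1
      | linear_combination w1
      | linear_combination w2
      | linear_combination w3
      | linear_combination w4
      | linear_combination m1
      | linear_combination m2
      | linear_combination m3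
      | linear_combination m6
      | linear_combination -n1
      | linear_combination -n2
      | linear_combination -n3
      | linear_combination -m4
      | linear_combination -m5
      | linear_combination -m7
      | linear_combination -f (A + 1 + 1) * n2
      | linear_combination -f (A + 1 + 1) * m7
      | linear_combination f (A - 1) * w4
      | linear_combination f (A - 1) * m2
      | linear_combination f (A + 1 + 1) * w2
      | linear_combination f (A + 1 + 1) * m6
      | linear_combination f (A - 1) * n3
      | linear_combination -f (A - 1) * m5

/-- `b` is obtained from `a` by a unit step. -/
def Stp (a b : ℤ × ℤ) : Prop := b = a + e1 ∨ b = a + e2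

lemma faceW_ne {q : ℝ} {lam ω : ℂ} {a b c d : ℤ × ℤ} {u v : ℂ}
    (h : faceW q lam ω a b c d u v ≠ 0) : Stp a b ∧ Stp a c ∧ Stp b d ∧ Stp c d := by
  unfold faceW at h
  have hc : a + e1 + e2 = a + e2 + e1 := add_right_comm _ _ _
  split_ifs at h with h1 h2 h3 h4 h5 h6
  · obtain ⟨rfl, rfl, rfl⟩ := h1; simp [Stp]
  · obtain ⟨rfl, rfl, rfl⟩ := h2; simp [Stp]
  · obtain ⟨rfl, rfl, rfl⟩ := h3; simp [Stp, hc]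
  · obtain ⟨rfl, rfl, rfl⟩ := h4; simp [Stp, hc]
  · obtain ⟨rfl, rfl, rfl⟩ := h5; simp [Stp]
  · obtain ⟨rfl, rfl, rfl⟩ := h6; simp [Stp, hc]
  · exact absurd rfl h

lemma faceW_FF (q : ℝ) (lam ω : ℂ) (P x0 x1 x2 x3 : ℤ × ℤ) (u v : ℂ) :
    faceW q lam ω (P + x0) (P + x1) (P + x2) (P + x3) u v =
      FF (brak q lam) (aSc ω P) x0 x1 x2 x3 (u - v) := faceW_rel q lam ω P x0 x1 x2 x3 u v

lemma ybe_abs {q : ℝ} (hq0 : 0 < q) (hq1 : q < 1) {lam ω : ℂ} (h1 : brak q lam 1 ≠ 0)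
    (hA : ∀ b : ℤ × ℤ, brak q lam (aSc ω b) ≠ 0) (P p r z zz g : ℤ × ℤ) (u2 u1 v : ℂ) :
    faceW q lam ω P p r (p + e1) u2 v * faceW q lam ω r (p + e1) z zz u1 v *
        faceW q lam ω p g (p + e1) zz u2 u1 +
      faceW q lam ω P p r (p + e2) u2 v * faceW q lam ω r (p + e2) z zz u1 v *
        faceW q lam ω p g (p + e2) zz u2 u1 =
    faceW q lam ω P (P + e1) r z u2 u1 * faceW q lam ω P p (P + e1) g u1 v *
        faceW q lam ω (P + e1) g z zz u2 v +
      faceW q lam ω P (P + e2) r z u2 u1 * faceW q lam ω P p (P + e2) g u1 v *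
        faceW q lam ω (P + e2) g z zz u2 v := by
  by_cases H : Stp P p ∧ Stp P r ∧ Stp r z ∧ Stp z zz ∧ Stp p g
  · obtain ⟨hp, hr, hz, hzz, hg⟩ := H
    have key : ∀ a b, Stp a b → ∃ t : ℤ × ℤ, (t = (1, 0) ∨ t = (0, 1)) ∧ b = a + t := by
      rintro a b (h | h)
      · exact ⟨_, Or.inl rfl, h⟩
      · exact ⟨_, Or.inr rfl, h⟩
    obtain ⟨p', kp, rfl⟩ := key _ _ hp
    obtain ⟨r', kr, rfl⟩ := key _ _ hr
    obtain ⟨z', kz, rfl⟩ := key _ _ hz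
    obtain ⟨zz', kzz, rfl⟩ := key _ _ hzz
    obtain ⟨g', kg, rfl⟩ := key _ _ hg
    have hB : brak q lam (aSc ω P + 1) ≠ 0 := by
      have := hA (P + e1)
      rwa [show aSc ω (P + e1) = aSc ω P + 1 by simp [aSc, e1]; ring] at this
    have Y := ybe_rel (brak q lam) (brak_weiFun hq0 hq1 lam) h1 (aSc ω P) (hA P) hB (u1 - v)
      (u2 - u1) p' r' z' zz' g' kp kr kz kzz kg
    have e : u1 - v + (u2 - u1) = u2 - v := by ring
    simp only [e, ← faceW_FF q lam ω P, add_zero] at Y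
    simpa only [e1, e2, add_assoc] using Y
  · have zl : ∀ t : ℤ × ℤ, faceW q lam ω P p r t u2 v * faceW q lam ω r t z zz u1 v *
        faceW q lam ω p g t zz u2 u1 = 0 := by
      intro t
      by_contra hne
      obtain ⟨⟨ha, hb⟩, hc⟩ : (_ ∧ _) ∧ _ := by simpa [mul_eq_zero, not_or] using hne
      have a1 := faceW_ne ha
      have a2 := faceW_ne hb
      have a3 := faceW_ne hc
      exact H ⟨a1.1, a1.2.1, a2.2.1, a2.2.2.2, a3.1⟩
    have zr : ∀ t : ℤ × ℤ, faceW q lam ω P t r z u2 u1 * faceW q lam ω P p t g u1 v *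
        faceW q lam ω t g z zz u2 v = 0 := by
      intro t
      by_contra hne
      obtain ⟨⟨ha, hb⟩, hc⟩ : (_ ∧ _) ∧ _ := by simpa [mul_eq_zero, not_or] using hne
      have a1 := faceW_ne ha
      have a2 := faceW_ne hb
      have a3 := faceW_ne hc
      exact H ⟨a2.1, a1.2.1, a1.2.2.2, a3.2.2.2, a2.2.2.1⟩
    rw [zl, zl, zr, zr]

lemma Stp.le {a b : ℤ × ℤ} (h : Stp a b) : a ≤ b := by
  rcases h with rfl | rfl <;> simp [e1, e2, Prod.le_def]

lemma sum_box {lo hi P Q : ℤ × ℤ} (hP : P ∈ Finset.Icc lo hi) (hQ : Q ∈ Finset.Icc lo hi)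
    (X : ℤ × ℤ → ℂ) (hX : ∀ t, X t ≠ 0 → Stp P t ∧ Stp t Q) :
    ∑ t : ↥(Finset.Icc lo hi), X t = X (P + e1) + X (P + e2) := by
  rw [Finset.sum_coe_sort (Finset.Icc lo hi) X]
  rw [← finsum_eq_sum_of_support_subset, finsum_eq_sum_of_support_subset (s := {P + e1, P + e2})]
  · rw [Finset.sum_pair]
    simp [e1, e2]
  · intro t ht
    have := (hX t ht).1
    simpa [Stp] using this
  · intro t ht
    obtain ⟨h1, h2⟩ := hX t ht
    rw [Finset.mem_Icc] at hP hQ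
    simp only [Finset.coe_Icc, Set.mem_Icc]
    exact ⟨hP.1.trans h1.le, h2.le.trans hQ.2⟩

lemma ybe_box {q : ℝ} (hq0 : 0 < q) (hq1 : q < 1) {lam ω : ℂ} (h1 : brak q lam 1 ≠ 0)
    (hA : ∀ b : ℤ × ℤ, brak q lam (aSc ω b) ≠ 0) {lo hi : ℤ × ℤ}
    (P p r z zz g : ↥(Finset.Icc lo hi)) (u2 u1 v : ℂ) :
    ∑ t : ↥(Finset.Icc lo hi), faceW q lam ω P p r t u2 v * faceW q lam ω r t z zz u1 v *
        faceW q lam ω p g t zz u2 u1 =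
    ∑ t : ↥(Finset.Icc lo hi), faceW q lam ω P t r z u2 u1 *
        (faceW q lam ω P p t g u1 v * faceW q lam ω t g z zz u2 v) := by
  rw [sum_box p.2 zz.2 (fun t => faceW q lam ω P p r t u2 v * faceW q lam ω r t z zz u1 v *
        faceW q lam ω p g t zz u2 u1), sum_box P.2 z.2 (fun t => faceW q lam ω P t r z u2 u1 *
        (faceW q lam ω P p t g u1 v * faceW q lam ω t g z zz u2 v))]
  · have := ybe_abs hq0 hq1 h1 hA P p r z zz g u2 u1 v
    rw [this]; ring
  · intro t hne
    obtain ⟨ha, hb, hc⟩ : _ ∧ _ ∧ _ := by simpa [mul_eq_zero, not_or] using hne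
    exact ⟨(faceW_ne ha).1, (faceW_ne ha).2.2.1⟩
  · intro t hne
    obtain ⟨⟨ha, hb⟩, hc⟩ : (_ ∧ _) ∧ _ := by simpa [mul_eq_zero, not_or] using hne
    exact ⟨(faceW_ne ha).2.2.1, (faceW_ne hb).2.2.1⟩


section paths
variable {β : Type*} [Fintype β] [DecidableEq β]

/-- Ordered product of a sequence of matrices. -/
def pathProd (A : ℕ → Matrix β β ℂ) : ℕ → Matrix β β ℂ
  | 0 => 1
  | n + 1 => pathProd A n * A n

lemma path_sum (A : ℕ → Matrix β β ℂ) (n : ℕ) (x y : β) :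
    pathProd A n x y = ∑ r : Fin (n + 1) → β, if r 0 = x ∧ r (Fin.last n) = y then
      ∏ k : Fin n, A k (r k.castSucc) (r k.succ) else 0 := by
  induction n generalizing y with
  | zero =>
    rw [← Equiv.sum_comp (Equiv.funUnique (Fin 1) β).symm]
    simp [pathProd, Matrix.one_apply, Finset.filter_and, Finset.filter_eq']
    split_ifs with h
    · subst h; simp
    · simp [Ne.symm h]
  | succ n ih =>
    rw [← Equiv.sum_comp (Fin.snocEquiv (fun _ => β)), Fintype.sum_prod_type_right]
    simp only [pathProd, Matrix.mul_apply]
    simp only [ih, Finset.sum_mul]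
    rw [Finset.sum_comm]
    refine Finset.sum_congr rfl fun r _ => ?_
    rw [Finset.sum_eq_single (r (Fin.last n)), Finset.sum_eq_single y]
    · have h0 : (Fin.snoc (α := fun _ => β) r y : Fin (n + 1 + 1) → β) 0 = r 0 := by
        rw [← Fin.castSucc_zero, Fin.snoc_castSucc]
      simp only [Fin.snocEquiv, Equiv.coe_fn_mk, Fin.snoc_last, h0, and_true,
        Fin.prod_univ_castSucc, Fin.snoc_castSucc, Fin.val_castSucc, Fin.succ_castSucc,
        Fin.val_last, Fin.succ_last, ite_mul, zero_mul]
    · intro w _ hw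
      rw [if_neg]
      simp only [Fin.snocEquiv, Equiv.coe_fn_mk, Fin.snoc_last]
      tauto
    · simp
    · intro w _ hw
      rw [if_neg, zero_mul]
      tauto
    · simp

lemma path_intertwine (A A' R : ℕ → Matrix β β ℂ) (n : ℕ)
    (h : ∀ k < n, A k * R (k + 1) = R k * A' k) :
    pathProd A n * R n = R 0 * pathProd A' n := by
  induction n with
  | zero => simp [pathProd]
  | succ n ih =>
    rw [pathProd, pathProd, mul_assoc, h n (Nat.lt_succ_self n), ← mul_assoc,
      ih (fun k hk => h k (Nat.lt_succ_of_lt hk)), mul_assoc]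

end paths

open scoped Classical in
/-- Row to row transfer matrix with fixed boundary steps. -/
def rowT (q : ℝ) (lam ω : ℂ) (M : ℕ) (v : ℕ → ℂ) (lo hi : ℤ × ℤ) (u : ℂ) :
    Matrix (Fin (M + 1) → ↥(Finset.Icc lo hi)) (Fin (M + 1) → ↥(Finset.Icc lo hi)) ℂ :=
  fun p r => if (r 0 : ℤ × ℤ) = (p 0 : ℤ × ℤ) + e1 ∧
      (r (Fin.last M) : ℤ × ℤ) = (p (Fin.last M) : ℤ × ℤ) + e2 then
    ∏ k : Fin M, faceW q lam ω (p k.castSucc) (p k.succ) (r k.castSucc) (r k.succ) u (v (k + 1))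
  else 0

/-- Two-row column matrix. -/
def colA (q : ℝ) (lam ω : ℂ) (M : ℕ) (v : ℕ → ℂ) (lo hi : ℤ × ℤ) (u2 u1 : ℂ)
    (p z : Fin (M + 1) → ↥(Finset.Icc lo hi)) (k : ℕ) :
    Matrix ↥(Finset.Icc lo hi) ↥(Finset.Icc lo hi) ℂ :=
  Matrix.of fun t t' =>
    faceW q lam ω (p (Fin.ofNat (M + 1) k)) (p (Fin.ofNat (M + 1) (k + 1))) t t' u2 (v (k + 1)) *
    faceW q lam ω t t' (z (Fin.ofNat (M + 1) k)) (z (Fin.ofNat (M + 1) (k + 1))) u1 (v (k + 1))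

/-- The intertwining matrix. -/
def colR (q : ℝ) (lam ω : ℂ) (M : ℕ) (lo hi : ℤ × ℤ) (u2 u1 : ℂ)
    (p z : Fin (M + 1) → ↥(Finset.Icc lo hi)) (k : ℕ) :
    Matrix ↥(Finset.Icc lo hi) ↥(Finset.Icc lo hi) ℂ :=
  Matrix.of fun t g => faceW q lam ω (p (Fin.ofNat (M + 1) k)) g t (z (Fin.ofNat (M + 1) k)) u2 u1

lemma rowT_mul (q : ℝ) (lam ω : ℂ) (M : ℕ) (v : ℕ → ℂ) (lo hi : ℤ × ℤ) (u2 u1 : ℂ)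
    (p z : Fin (M + 1) → ↥(Finset.Icc lo hi)) (x y : ↥(Finset.Icc lo hi))
    (hx : (x : ℤ × ℤ) = (p 0 : ℤ × ℤ) + e1) (hy : (y : ℤ × ℤ) = (p (Fin.last M) : ℤ × ℤ) + e2)
    (hz0 : (z 0 : ℤ × ℤ) = (x : ℤ × ℤ) + e1) (hzM : (z (Fin.last M) : ℤ × ℤ) = (y : ℤ × ℤ) + e2) :
    (rowT q lam ω M v lo hi u2 * rowT q lam ω M v lo hi u1) p z =
      pathProd (colA q lam ω M v lo hi u2 u1 p z)
        M x y := by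
  classical
  have o1 : ∀ k : Fin M, Fin.ofNat (M + 1) (k : ℕ) = k.castSucc := by
    intro k; ext; simp [Fin.ofNat]
  have o2 : ∀ k : Fin M, Fin.ofNat (M + 1) ((k : ℕ) + 1) = k.succ := by
    intro k; ext; simp [Fin.ofNat]
  rw [path_sum, Matrix.mul_apply]
  refine Finset.sum_congr rfl fun r _ => ?_
  simp only [o1, o2, rowT, colA, Matrix.of_apply]
  rw [← hx, ← hy]
  by_cases h : r 0 = x ∧ r (Fin.last M) = y
  · obtain ⟨h0, hM⟩ := h
    rw [h0, hM]
    rw [if_pos ⟨rfl, rfl⟩, if_pos ⟨hz0, hzM⟩, if_pos ⟨rfl, rfl⟩, Finset.prod_mul_distrib]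
  · rw [if_neg h, if_neg, zero_mul]
    rintro ⟨h0, hM⟩
    exact h ⟨Subtype.ext h0, Subtype.ext hM⟩

lemma rowT_comm {q : ℝ} (hq0 : 0 < q) (hq1 : q < 1) {lam ω : ℂ} (h1 : brak q lam 1 ≠ 0)
    (hA : ∀ b : ℤ × ℤ, brak q lam (aSc ω b) ≠ 0) (M : ℕ) (v : ℕ → ℂ) (lo hi : ℤ × ℤ)
    (u2 u1 : ℂ) :
    brak q lam (1 + u1 - u2) • (rowT q lam ω M v lo hi u2 * rowT q lam ω M v lo hi u1) =
    brak q lam (1 + u2 - u1) • (rowT q lam ω M v lo hi u1 * rowT q lam ω M v lo hi u2) := by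
  classical
  ext p z
  simp only [Matrix.smul_apply, smul_eq_mul]
  by_cases H : (z 0 : ℤ × ℤ) = (p 0 : ℤ × ℤ) + e1 + e1 ∧
      (z (Fin.last M) : ℤ × ℤ) = (p (Fin.last M) : ℤ × ℤ) + e2 + e2
  · obtain ⟨hz0, hzM⟩ := H
    have mem : ∀ (a b : ↥(Finset.Icc lo hi)) (t : ℤ × ℤ), Stp a t → Stp t b →
        t ∈ Finset.Icc lo hi := by
      intro a b t h h'
      have ha := Finset.mem_Icc.1 a.2
      have hb := Finset.mem_Icc.1 b.2
      exact Finset.mem_Icc.2 ⟨ha.1.trans h.le, h'.le.trans hb.2⟩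
    obtain ⟨x, hx⟩ : ∃ x : ↥(Finset.Icc lo hi), (x : ℤ × ℤ) = (p 0 : ℤ × ℤ) + e1 :=
      ⟨⟨_, mem (p 0) (z 0) _ (Or.inl rfl) (Or.inl hz0)⟩, rfl⟩
    obtain ⟨y, hy⟩ : ∃ y : ↥(Finset.Icc lo hi), (y : ℤ × ℤ) = (p (Fin.last M) : ℤ × ℤ) + e2 :=
      ⟨⟨_, mem (p (Fin.last M)) (z (Fin.last M)) _ (Or.inr rfl) (Or.inr hzM)⟩, rfl⟩
    rw [← hx] at hz0
    rw [← hy] at hzM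
    rw [rowT_mul q lam ω M v lo hi u2 u1 p z x y hx hy hz0 hzM,
      rowT_mul q lam ω M v lo hi u1 u2 p z x y hx hy hz0 hzM]
    have I := path_intertwine (β := ↥(Finset.Icc lo hi))
      (colA q lam ω M v lo hi u2 u1 p z)
      (colA q lam ω M v lo hi u1 u2 p z)
      (colR q lam ω M lo hi u2 u1 p z) M
      (by
        intro k _
        ext r g
        simp only [Matrix.mul_apply, colA, colR, Matrix.of_apply]
        exact ybe_box hq0 hq1 h1 hA _ _ _ _ _ _ u2 u1 (v (k + 1)))
    have J := congrFun (congrFun I x) y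
    rw [Matrix.mul_apply, Matrix.mul_apply, Finset.sum_eq_single y, Finset.sum_eq_single x] at J
    · have oM : Fin.ofNat (M + 1) M = Fin.last M := by ext; simp [Fin.ofNat]
      have o0 : Fin.ofNat (M + 1) 0 = 0 := by ext; simp [Fin.ofNat]
      simp only [colR, Matrix.of_apply] at J
      rw [oM, o0, hz0, hzM, hx, hy] at J
      have f1 : ∀ a : ℤ × ℤ, faceW q lam ω a (a + e1) (a + e1) (a + e1 + e1) u2 u1 =
          brak q lam (1 + u2 - u1) / brak q lam 1 := by
        intro a; simp [faceW, add_sub_assoc]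
      have f2 : ∀ a : ℤ × ℤ, faceW q lam ω a (a + e2) (a + e2) (a + e2 + e2) u2 u1 =
          brak q lam (1 + u1 - u2) / brak q lam 1 := by
        intro a
        rw [show 1 + u1 - u2 = 1 - (u2 - u1) by ring]
        simp [faceW, e1, e2]
      rw [f1, f2] at J
      field_simp at J
      linear_combination J
    · intro t _ ht
      by_contra hne
      have := (faceW_ne (left_ne_zero_of_mul hne))
      have o0 : Fin.ofNat (M + 1) 0 = 0 := by ext; simp [Fin.ofNat]
      rw [o0, hz0, hx] at this
      obtain ⟨ha, -, hb, -⟩ := this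
      apply ht
      apply Subtype.ext
      rw [hx]
      rcases ha with ha | ha
      · exact ha
      · rw [ha] at hb
        rcases hb with hb | hb <;> simp [Prod.ext_iff, e1, e2] at hb <;> omega
    · simp
    · intro t _ ht
      by_contra hne
      have := (faceW_ne (right_ne_zero_of_mul hne))
      have oM : Fin.ofNat (M + 1) M = Fin.last M := by ext; simp [Fin.ofNat]
      rw [oM, hzM, hy] at this
      obtain ⟨-, ha, -, hb⟩ := this
      apply ht
      apply Subtype.ext
      rw [hy]
      rcases ha with ha | ha
      · rw [ha] at hb
        rcases hb with hb | hb <;> simp [Prod.ext_iff, e1, e2] at hb <;> omega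
      · exact ha
    · simp
  · have hz : ∀ w w' : ℂ, (rowT q lam ω M v lo hi w * rowT q lam ω M v lo hi w') p z = 0 := by
      intro w w'
      rw [Matrix.mul_apply]
      refine Finset.sum_eq_zero fun r _ => ?_
      by_contra hne
      have ha := left_ne_zero_of_mul hne
      have hb := right_ne_zero_of_mul hne
      simp only [rowT, ne_eq, ite_eq_right_iff, Classical.not_imp] at ha hb
      apply H
      rw [← ha.1.1, ← ha.1.2]
      exact hb.1
    rw [hz, hz, mul_zero, mul_zero]


section perms

/-- Product of a function over the inversions of a permutation. -/
def prodInv {N : ℕ} {R : Type*} [CommMonoid R] (σ : Equiv.Perm (Fin N))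
    (g : Fin N → Fin N → R) : R :=
  ∏ j : Fin N, ∏ k : Fin N,
    if (j : ℕ) < (k : ℕ) ∧ (σ k : ℕ) < (σ j : ℕ) then g (σ j) (σ k) else 1

lemma prodInv_swap {N : ℕ} {R : Type*} [CommMonoid R] (σ : Equiv.Perm (Fin N))
    (g : Fin N → Fin N → R) (i i' : Fin N) (hi : (i' : ℕ) = i + 1) (h : σ i' < σ i) :
    prodInv σ g = prodInv (σ * Equiv.swap i i') g * g (σ i) (σ i') := by
  have hs : ∀ F : Fin N → R, ∏ j, F j = ∏ j, F (Equiv.swap i i' j) := fun F =>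
    (Equiv.prod_comp (Equiv.swap i i') F).symm
  have hne : i ≠ i' := by intro h; rw [h] at hi; omega
  have hg : g (σ i) (σ i') = ∏ j : Fin N, ∏ k : Fin N, if j = i ∧ k = i' then g (σ i) (σ i') else 1 := by
    rw [Finset.prod_eq_single i, Finset.prod_eq_single i']
    · simp
    · intro b _ hb; simp [hb]
    · simp
    · intro b _ hb; simp [hb]
    · simp
  have hτ : prodInv (σ * Equiv.swap i i') g = ∏ j : Fin N, ∏ k : Fin N,
      if ((Equiv.swap i i' j : Fin N) : ℕ) < (Equiv.swap i i' k : Fin N) ∧ (σ k : ℕ) < (σ j : ℕ)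
        then g (σ j) (σ k) else 1 := by
    unfold prodInv
    rw [hs]
    refine Finset.prod_congr rfl fun j _ => ?_
    rw [hs]
    simp
  rw [hτ, hg]
  simp only [← Finset.prod_mul_distrib]
  unfold prodInv
  refine Finset.prod_congr rfl fun j _ => Finset.prod_congr rfl fun k _ => ?_
  by_cases hji : j = i
  · subst hji
    by_cases hki : k = i'
    · subst hki
      have h' : (σ k : ℕ) < σ j := h
      simp [h', hi]
    · by_cases hkj : k = j
      · subst hkj; simp [hki]
      · have hk1 : (k : ℕ) ≠ j := fun h => hkj (Fin.ext h)
        have hk2 : (k : ℕ) ≠ i' := fun h => hki (Fin.ext h)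
        rw [Equiv.swap_apply_left, Equiv.swap_apply_of_ne_of_ne hkj hki]
        simp only [hki, and_false, if_false, mul_one]
        have : ((j : ℕ) < k) ↔ ((i' : ℕ) < k) := by omega
        simp only [this]
  · have hj1 : (j : ℕ) ≠ i := fun h => hji (Fin.ext h)
    simp only [hji, false_and, if_false, mul_one]
    by_cases hji' : j = i'
    · subst hji'
      rw [Equiv.swap_apply_right]
      by_cases hki : k = i
      · subst hki
        have h' : ¬ (σ k : ℕ) < σ j := not_lt.2 (le_of_lt h)
        simp [h']
      · by_cases hkj : k = j
        · subst hkj; simp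
        · have hk1 : (k : ℕ) ≠ j := fun h => hkj (Fin.ext h)
          have hk2 : (k : ℕ) ≠ i := fun h => hki (Fin.ext h)
          rw [Equiv.swap_apply_of_ne_of_ne hki hkj]
          have : ((j : ℕ) < k) ↔ ((i : ℕ) < k) := by omega
          simp only [this]
    · have hj2 : (j : ℕ) ≠ i' := fun h => hji' (Fin.ext h)
      rw [Equiv.swap_apply_of_ne_of_ne hji hji']
      have : ((j : ℕ) < k) ↔ ((j : ℕ) < (Equiv.swap i i' k : Fin N)) := by
        rw [Equiv.swap_apply_def]
        split_ifs with h1 h2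
        · subst h1; omega
        · subst h2; omega
        · rfl
      simp only [this]

variable {S : Type*} [Ring S] [Algebra ℂ S]

/-- Ordered product `T(w N) ⋯ T(w 1)`. -/
def ordP (T : ℂ → S) (w : ℕ → ℂ) : ℕ → S
  | 0 => 1
  | n + 1 => T (w (n + 1)) * ordP T w n

lemma ordP_congr (T : ℂ → S) (w w' : ℕ → ℂ) (n : ℕ) (h : ∀ k, 1 ≤ k → k ≤ n → w k = w' k) :
    ordP T w n = ordP T w' n := by
  induction n with
  | zero => rfl
  | succ n ih =>
    rw [ordP, ordP, h (n + 1) (by omega) le_rfl, ih (fun k h1 h2 => h k h1 (by omega))]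

lemma ordP_swap (T : ℂ → S) (φ : ℂ → ℂ → ℂ)
    (hT : ∀ a b, φ a b • (T b * T a) = φ b a • (T a * T b)) (w w' : ℕ → ℂ) (m N : ℕ)
    (hm : m + 2 ≤ N) (h1 : w' (m + 1) = w (m + 2)) (h2 : w' (m + 2) = w (m + 1))
    (h : ∀ k, k ≠ m + 1 → k ≠ m + 2 → 1 ≤ k → k ≤ N → w k = w' k) :
    φ (w (m + 1)) (w (m + 2)) • ordP T w N = φ (w (m + 2)) (w (m + 1)) • ordP T w' N := by
  induction N, hm using Nat.le_induction with
  | base =>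
    rw [ordP, ordP, ordP, ordP, h1, h2, ordP_congr T w w' m
      (fun k h3 h4 => h k (by omega) (by omega) h3 (by omega)), ← mul_assoc, ← mul_assoc,
      ← smul_mul_assoc, hT, smul_mul_assoc]
  | succ n hn ih =>
    rw [ordP, ordP, ← mul_smul_comm, ih (fun k h3 h4 h5 h6 => h k h3 h4 h5 (by omega)),
      mul_smul_comm, h (n + 1) (by omega) (by omega) (by omega) le_rfl]

/-- The permuted parameters. -/
def permU {N : ℕ} (u : ℕ → ℂ) (σ : Equiv.Perm (Fin N)) : ℕ → ℂ :=
  fun n => if h : n - 1 < N then u ((σ ⟨n - 1, h⟩ : ℕ) + 1) else u n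

lemma perm_exists_descent {N : ℕ} (σ : Equiv.Perm (Fin N)) (hσ : σ ≠ 1) :
    ∃ i i' : Fin N, (i' : ℕ) = i + 1 ∧ σ i' < σ i := by
  by_contra hcon
  push Not at hcon
  apply hσ
  cases N with
  | zero => exact Subsingleton.elim _ _
  | succ n =>
    have hm : StrictMono σ := by
      rw [Fin.strictMono_iff_lt_succ]
      intro i
      refine lt_of_le_of_ne (hcon i.castSucc i.succ (by simp)) ?_
      intro h
      have := σ.injective h
      exact absurd this (ne_of_lt (Fin.castSucc_lt_succ))
    have : (hm.orderIsoOfSurjective σ σ.surjective) = OrderIso.refl _ := Subsingleton.elim _ _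
    ext x
    have h2 := congrArg (fun e : Fin (n + 1) ≃o Fin (n + 1) => e x) this
    simpa using congrArg Fin.val h2

lemma perm_exchange (T : ℂ → S) (φ : ℂ → ℂ → ℂ)
    (hT : ∀ a b, φ a b • (T b * T a) = φ b a • (T a * T b)) (u : ℕ → ℂ) (N : ℕ) :
    ∀ (m : ℕ) (σ : Equiv.Perm (Fin N)), prodInv σ (fun _ _ => (2 : ℕ)) = m →
    prodInv σ (fun a b => φ (u ((b : ℕ) + 1)) (u ((a : ℕ) + 1))) • ordP T u N =
    prodInv σ (fun a b => φ (u ((a : ℕ) + 1)) (u ((b : ℕ) + 1))) • ordP T (permU u σ) N := by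
  intro m
  induction m using Nat.strong_induction_on with
  | _ m ih =>
  intro σ hσm
  by_cases hσ : σ = 1
  · subst hσ
    have e : ∀ g : Fin N → Fin N → ℂ, prodInv 1 g = 1 := by
      intro g
      unfold prodInv
      refine Finset.prod_eq_one fun j _ => Finset.prod_eq_one fun k _ => ?_
      rw [if_neg]
      simp only [Equiv.Perm.one_apply]
      omega
    rw [e, e]
    congr 1
    apply ordP_congr
    intro k h1 h2
    have h3 : k - 1 < N := by omega
    simp only [permU, h3, dif_pos, Equiv.Perm.one_apply]
    congr 1; omega
  · obtain ⟨i, i', hi, hlt⟩ := perm_exists_descent σ hσ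
    have hpos : 0 < prodInv (σ * Equiv.swap i i') (fun _ _ => (2 : ℕ)) := by
      unfold prodInv
      refine Finset.prod_pos fun j _ => Finset.prod_pos fun k _ => ?_
      split_ifs <;> norm_num
    have hlt' : prodInv (σ * Equiv.swap i i') (fun _ _ => (2 : ℕ)) < m := by
      have := prodInv_swap σ (fun _ _ => (2 : ℕ)) i i' hi hlt
      omega
    have IH := ih _ hlt' (σ * Equiv.swap i i') rfl
    rw [prodInv_swap σ _ i i' hi hlt, prodInv_swap σ _ i i' hi hlt]
    rw [mul_comm, mul_smul, IH, smul_comm, mul_smul]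
    congr 1
    have hi1 : (i : ℕ) + 2 ≤ N := by have := i'.2; omega
    have a1 : permU u (σ * Equiv.swap i i') ((i : ℕ) + 1) = u ((σ i' : ℕ) + 1) := by
      have : (i : ℕ) + 1 - 1 < N := by omega
      simp [permU]
    have a2 : permU u (σ * Equiv.swap i i') ((i : ℕ) + 2) = u ((σ i : ℕ) + 1) := by
      have h3 : (i : ℕ) + 2 - 1 < N := by omega
      have h4 : (⟨(i : ℕ) + 2 - 1, h3⟩ : Fin N) = i' := by ext; simp; omega
      simp only [permU, h3, dif_pos, h4, Equiv.Perm.mul_apply, Equiv.swap_apply_right]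
    have b1 : permU u σ ((i : ℕ) + 1) = u ((σ i : ℕ) + 1) := by
      simp [permU]
    have b2 : permU u σ ((i : ℕ) + 2) = u ((σ i' : ℕ) + 1) := by
      have h3 : (i : ℕ) + 2 - 1 < N := by omega
      have h4 : (⟨(i : ℕ) + 2 - 1, h3⟩ : Fin N) = i' := by ext; simp; omega
      simp only [permU, h3, dif_pos, h4]
    have key := ordP_swap T φ hT (permU u (σ * Equiv.swap i i')) (permU u σ) i N hi1
      (by rw [b1, a2]) (by rw [b2, a1]) (by
        intro k k1 k2 k3 k4
        have h3 : k - 1 < N := by omega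
        simp only [permU, h3, dif_pos, Equiv.Perm.mul_apply]
        rw [Equiv.swap_apply_of_ne_of_ne]
        · intro h; have := congrArg Fin.val h; simp at this; omega
        · intro h; have := congrArg Fin.val h; simp at this; omega)
    rw [a1, a2] at key
    exact key

end perms


lemma pathProd_succ_left {β : Type*} [Fintype β] [DecidableEq β] (A : ℕ → Matrix β β ℂ) (n : ℕ) :
    pathProd A (n + 1) = A 0 * pathProd (fun k => A (k + 1)) n := by
  induction n with
  | zero => simp [pathProd]
  | succ n ih => rw [pathProd, ih, pathProd, mul_assoc]

lemma pathProd_ordP {β : Type*} [Fintype β] [DecidableEq β] (T : ℂ → Matrix β β ℂ) (u : ℕ → ℂ)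
    (N : ℕ) : pathProd (fun k => T (u (N - k))) N = ordP T u N := by
  induction N with
  | zero => rfl
  | succ n ih =>
    rw [pathProd_succ_left, ordP, ← ih]
    simp only [Nat.add_sub_add_right, Nat.sub_zero]

lemma stp_le_add {a b : ℤ × ℤ} (h : Stp a b) : b ≤ a + (1, 1) := by
  rcases h with rfl | rfl <;> simp [e1, e2, Prod.le_def]

lemma btmCount_le (N : ℕ) (x : ℕ → ℕ) (k : ℕ) : btmCount N x k ≤ N := by
  unfold btmCount
  refine (Finset.card_filter_le _ _).trans ?_
  simp

open scoped Classical in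
/-- The summand of the partition function. -/
def confW (q : ℝ) (lam ω12 : ℂ) (M N : ℕ) (u v : ℕ → ℂ) (x : ℕ → ℕ)
    (a : ℤ × ℤ) (s : Fin (N + 1) × Fin (M + 1) → ℤ × ℤ) : ℂ :=
    if (∀ k : Fin (M + 1), s (0, k) = a + ((k : ℕ) : ℤ) • e1) ∧
       (∀ i : Fin (N + 1), s (i, 0) = a + ((i : ℕ) : ℤ) • e1) ∧
       (∀ i : Fin (N + 1), s (i, Fin.last M) = a + (M : ℤ) • e1 + ((i : ℕ) : ℤ) • e2) ∧
       (∀ k : Fin (M + 1), s (Fin.last N, k) =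
          a + ((N : ℤ) + ((k : ℕ) : ℤ) - (btmCount N x (k : ℕ) : ℤ)) • e1 +
            (btmCount N x (k : ℕ) : ℤ) • e2)
    then
      ∏ i : Fin N, ∏ k : Fin M,
        faceW q lam ω12 (s (i.castSucc, k.castSucc)) (s (i.castSucc, k.succ))
          (s (i.succ, k.castSucc)) (s (i.succ, k.succ)) (u (N - (i : ℕ))) (v ((k : ℕ) + 1))
    else 0

lemma confW_support {q : ℝ} {lam ω12 : ℂ} {M N : ℕ} {u v : ℕ → ℂ} {x : ℕ → ℕ}
    {a : ℤ × ℤ} {s : Fin (N + 1) × Fin (M + 1) → ℤ × ℤ}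
    (h : confW q lam ω12 M N u v x a s ≠ 0) (i : Fin (N + 1)) (k : Fin (M + 1)) :
    s (i, k) ∈ Finset.Icc a (a + ((M + N : ℤ), (M + N : ℤ))) := by
  unfold confW at h
  rw [ne_eq, ite_eq_right_iff, Classical.not_imp] at h
  obtain ⟨⟨ht, hl, hr, hb⟩, hne⟩ := h
  rw [← ne_eq, Finset.prod_ne_zero_iff] at hne
  have hne' : ∀ (i : Fin N) (k : Fin M), Stp (s (i.castSucc, k.castSucc)) (s (i.succ, k.castSucc)) := by
    intro i k
    have h1 := hne i (Finset.mem_univ _)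
    rw [Finset.prod_ne_zero_iff] at h1
    exact (faceW_ne (h1 k (Finset.mem_univ _))).2.1
  have claim : ∀ (i : Fin (N + 1)) (k : Fin (M + 1)), a ≤ s (i, k) ∧
      s (i, k) ≤ a + ((M + (i : ℕ) : ℤ), (M + (i : ℕ) : ℤ)) := by
    intro i
    induction i using Fin.induction with
    | zero =>
      intro k
      have := k.2
      rw [ht]
      simp [e1, Prod.le_def]
      omega
    | succ i ih =>
      intro k
      induction k using Fin.lastCases with
      | last =>
        rw [hr]
        simp [e1, e2, Prod.le_def]
        omega
      | cast k =>
        have hs := hne' i k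
        have h1 := hs.le
        have h2 := stp_le_add hs
        have h3 := ih k.castSucc
        refine ⟨h3.1.trans h1, h2.trans ((add_le_add_left h3.2 (1, 1)).trans ?_)⟩
        simp [Prod.le_def, add_assoc]
  obtain ⟨h1, h2⟩ := claim i k
  refine Finset.mem_Icc.2 ⟨h1, h2.trans ?_⟩
  have := i.2
  simp [Prod.le_def]
  omega

lemma ite_iff_aux {P Q : Prop} {dP : Decidable P} {dQ : Decidable Q} (h : P ↔ Q) (x : ℂ) :
    @ite ℂ P dP x 0 = @ite ℂ Q dQ x 0 := by
  by_cases hP : P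
  · rw [if_pos hP, if_pos (h.1 hP)]
  · rw [if_neg hP, if_neg (fun hQ => hP (h.2 hQ))]

lemma partW_eq (q : ℝ) (lam ω12 : ℂ) (M N : ℕ) (x : ℕ → ℕ) (v : ℕ → ℂ) (a : ℤ × ℤ) :
    ∃ top bot : Fin (M + 1) → ↥(Finset.Icc a (a + ((M + N : ℤ), (M + N : ℤ)))), ∀ u : ℕ → ℂ,
    partW q lam ω12 M N u v x a =
      ordP (rowT q lam ω12 M v a (a + ((M + N : ℤ), (M + N : ℤ)))) u N top bot := by
  classical
  set hi : ℤ × ℤ := a + ((M + N : ℤ), (M + N : ℤ)) with hhi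
  obtain ⟨top, htop⟩ : ∃ top : Fin (M + 1) → ↥(Finset.Icc a hi),
      ∀ k, (top k : ℤ × ℤ) = a + ((k : ℕ) : ℤ) • e1 := by
    refine ⟨fun k => ⟨a + ((k : ℕ) : ℤ) • e1, ?_⟩, fun k => rfl⟩
    have := k.2
    rw [Finset.mem_Icc]
    simp [hhi, e1, Prod.le_def]
    omega
  obtain ⟨bot, hbot⟩ : ∃ bot : Fin (M + 1) → ↥(Finset.Icc a hi),
      ∀ k, (bot k : ℤ × ℤ) = a + ((N : ℤ) + ((k : ℕ) : ℤ) - (btmCount N x (k : ℕ) : ℤ)) • e1 +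
            (btmCount N x (k : ℕ) : ℤ) • e2 := by
    refine ⟨fun k => ⟨a + ((N : ℤ) + ((k : ℕ) : ℤ) - (btmCount N x (k : ℕ) : ℤ)) • e1 +
            (btmCount N x (k : ℕ) : ℤ) • e2, ?_⟩, fun k => rfl⟩
    have := k.2
    have := btmCount_le N x k
    rw [Finset.mem_Icc]
    simp [hhi, e1, e2, Prod.le_def]
    omega
  refine ⟨top, bot, fun u => ?_⟩
  rw [← pathProd_ordP, path_sum]
  have hinj : Function.Injective
      (fun (R : Fin (N + 1) → Fin (M + 1) → ↥(Finset.Icc a hi)) (ik : Fin (N + 1) × Fin (M + 1)) =>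
        (R ik.1 ik.2 : ℤ × ℤ)) := by
    intro R R' h
    funext i k
    exact Subtype.ext (congrFun h (i, k))
  have hP : partW q lam ω12 M N u v x a = ∑' s, confW q lam ω12 M N u v x a s := rfl
  rw [hP, ← hinj.tsum_eq, tsum_fintype]
  · refine Finset.sum_congr rfl fun R _ => ?_
    unfold confW rowT
    rw [Finset.prod_ite_zero, ← ite_and]
    refine ite_iff_aux ?_ _
    constructor
    · rintro ⟨ht, hl, hr, hb⟩
      refine ⟨⟨funext fun k => Subtype.ext ?_, funext fun k => Subtype.ext ?_⟩, fun i _ => ⟨?_, ?_⟩⟩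
      · rw [htop]; exact ht k
      · rw [hbot]; exact hb k
      · have h1 := hl i.succ
        have h2 := hl i.castSucc
        simp only at h1 h2
        rw [h1, h2]
        simp [add_smul, add_assoc]
      · have h1 := hr i.succ
        have h2 := hr i.castSucc
        simp only at h1 h2
        rw [h1, h2]
        simp [add_smul, add_assoc]
    · rintro ⟨⟨ht, hb⟩, hs⟩
      refine ⟨fun k => ?_, fun i => ?_, fun i => ?_, fun k => ?_⟩
      · simp only [ht, htop]
      · induction i using Fin.induction with
        | zero => simp only [ht, htop]; simp
        | succ i ih =>
          have := (hs i (Finset.mem_univ _)).1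
          simp only at ih ⊢
          rw [this, ih]
          simp [add_smul, add_assoc]
      · induction i using Fin.induction with
        | zero => simp only [ht, htop]; simp
        | succ i ih =>
          have := (hs i (Finset.mem_univ _)).2
          simp only at ih ⊢
          rw [this, ih]
          simp [add_smul, add_assoc]
      · simp only [hb, hbot]
  · intro s hs
    exact ⟨fun i k => ⟨s (i, k), confW_support hs i k⟩, rfl⟩


/-- for every permutation `σ ∈ S_N` the partition functions satisfy the
exchange relation
`∏_{j<k, σ(j)>σ(k)} [1+u_{σ(k)}-u_{σ(j)}] · W_{M,N}(u₁,…,u_N|⋯)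
  = ∏_{j<k, σ(j)>σ(k)} [1+u_{σ(j)}-u_{σ(k)}] · W_{M,N}(u_{σ(1)},…,u_{σ(N)}|⋯)`. -/
theorem statement6 (q : ℝ) (hq0 : 0 < q) (hq1 : q < 1) (lam : ℂ) (hlam : lam ≠ 0)
    (ω12 : ℂ) (M N : ℕ) (hN : 1 ≤ N) (hNM : N ≤ M)
    (u v : ℕ → ℂ) (x : ℕ → ℕ)
    (hx1 : 1 ≤ x 1) (hxmono : ∀ j k, 1 ≤ j → j < k → k ≤ N → x j < x k)
    (hxN : x N ≤ M) (a : ℤ × ℤ)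
    (hbr1 : brak q lam 1 ≠ 0)
    (hbrA : ∀ b : ℤ × ℤ, brak q lam (aSc ω12 b) ≠ 0)
    (hbrA' : ∀ b : ℤ × ℤ, brak q lam (-aSc ω12 b) ≠ 0)
    (σ : Equiv.Perm (Fin N)) :
    (∏ j : Fin N, ∏ k : Fin N,
        if (j : ℕ) < (k : ℕ) ∧ (σ k : ℕ) < (σ j : ℕ) then
          brak q lam (1 + u ((σ k : ℕ) + 1) - u ((σ j : ℕ) + 1))
        else 1) *
      partW q lam ω12 M N u v x a =
    (∏ j : Fin N, ∏ k : Fin N,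
        if (j : ℕ) < (k : ℕ) ∧ (σ k : ℕ) < (σ j : ℕ) then
          brak q lam (1 + u ((σ j : ℕ) + 1) - u ((σ k : ℕ) + 1))
        else 1) *
      partW q lam ω12 M N
        (fun n => if h : n - 1 < N then u ((σ ⟨n - 1, h⟩ : ℕ) + 1) else u n) v x a := by
  obtain ⟨top, bot, hP⟩ := partW_eq q lam ω12 M N x v a
  have E := perm_exchange (rowT q lam ω12 M v a (a + ((M + N : ℤ), (M + N : ℤ))))
    (fun a b => brak q lam (1 + a - b))
    (fun c d => rowT_comm hq0 hq1 hbr1 hbrA M v a (a + ((M + N : ℤ), (M + N : ℤ))) d c) u N _ σ rfl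
  have E2 := congrFun (congrFun E top) bot
  simp only [Matrix.smul_apply, smul_eq_mul] at E2
  rw [hP, hP]
  exact E2

end
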